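/- arXiv:1109.3205 — 2 statements merged into one kernel-verified Lean document; each statement's English description precedes it below -/
import Mathlib

section
/- Let R be a formal power series ring over a field with x1,...,x_{p-1}, y1,...,yq part of the variables, p ≥ 3. Suppose f ∈ R is a product of q irreducible factors each of order 1, f ∈ (x1⋯x_{p-1}, y1⋯yq), and f = x1⋯x_{p-1}·g1 + y1⋯yq·g2 where g2 is not a unit. Then g2 may be chosen in the ideal (x1,...,x_{p-1}, y1,...,yq); i.e., f ∈ (x1⋯x_{p-1}) + (y1⋯yq)·(x1,...,x_{p-1},y1,...,yq). -/
open MvPowerSeries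

namespace MvPowerSeries

section Kill

variable {σ K : Type*} [Field K]

/-- The part of `f` supported on the monomials free of the variables in `S`. -/
def killFun (S : Finset σ) (f : MvPowerSeries σ K) : MvPowerSeries σ K :=
  fun n => if ∀ s ∈ S, n s = 0 then coeff n f else 0

theorem coeff_killFun (S : Finset σ) (f : MvPowerSeries σ K) (n : σ →₀ ℕ) :
    coeff n (killFun S f) = if ∀ s ∈ S, n s = 0 then coeff n f else 0 := rfl

/-- Substitution of `0` for the variables in `S`, as a ring homomorphism. -/
def kill (S : Finset σ) : MvPowerSeries σ K →+* MvPowerSeries σ K where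
  toFun := killFun S
  map_one' := by
    classical
    ext n
    by_cases hn : n = 0
    · simp [coeff_killFun, hn]
    · simp [coeff_killFun, coeff_one, hn]
  map_zero' := by
    ext n
    simp [coeff_killFun]
  map_add' f g := by
    ext n
    simp only [coeff_killFun, map_add]
    split_ifs <;> simp
  map_mul' f g := by
    classical
    ext n
    simp only [coeff_killFun, coeff_mul]
    split_ifs with hn
    · refine Finset.sum_congr rfl fun ab hab => ?_
      obtain rfl := Finset.HasAntidiagonal.mem_antidiagonal.mp hab
      simp only [Finsupp.add_apply, Nat.add_eq_zero_iff] at hn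
      rw [if_pos fun s hs => (hn s hs).1, if_pos fun s hs => (hn s hs).2]
    · refine (Finset.sum_eq_zero fun ab hab => ?_).symm
      obtain rfl := Finset.HasAntidiagonal.mem_antidiagonal.mp hab
      split_ifs with h1 h2
      · exact absurd (fun s hs => by simp [h1 s hs, h2 s hs]) hn
      all_goals simp

theorem coeff_kill (S : Finset σ) (f : MvPowerSeries σ K) (n : σ →₀ ℕ) :
    coeff n (kill S f) = if ∀ s ∈ S, n s = 0 then coeff n f else 0 := rfl

theorem constantCoeff_kill (S : Finset σ) (f : MvPowerSeries σ K) :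
    constantCoeff (kill S f) = constantCoeff f := by
  rw [← coeff_zero_eq_constantCoeff_apply, coeff_kill]
  simp

theorem kill_kill [DecidableEq σ] (S T : Finset σ) (f : MvPowerSeries σ K) :
    kill S (kill T f) = kill (S ∪ T) f := by
  ext n
  simp only [coeff_kill, Finset.mem_union, or_imp, forall_and, ← ite_and]

theorem kill_X_of_mem {S : Finset σ} {s : σ} (hs : s ∈ S) :
    kill S (X s : MvPowerSeries σ K) = 0 := by
  classical
  ext n
  rw [coeff_kill, coeff_X]
  split_ifs with h1 h2
  · subst h2
    simpa using h1 s hs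
  all_goals simp

theorem kill_X_of_notMem {S : Finset σ} {s : σ} (hs : s ∉ S) :
    kill S (X s : MvPowerSeries σ K) = X s := by
  classical
  ext n
  rw [coeff_kill, coeff_X]
  split_ifs with h1 h2 h2
  · rfl
  · rfl
  · refine absurd (fun t ht => ?_) h1
    rw [h2, Finsupp.single_eq_of_ne]
    rintro rfl
    exact hs ht
  · rfl

theorem X_dvd_iff_kill_eq_zero {s : σ} {f : MvPowerSeries σ K} : X s ∣ f ↔ kill {s} f = 0 := by
  rw [X_dvd_iff, MvPowerSeries.ext_iff]
  simp [coeff_kill]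

theorem X_dvd_sub_kill (s : σ) (f : MvPowerSeries σ K) : X s ∣ f - kill {s} f := by
  rw [X_dvd_iff_kill_eq_zero, map_sub]
  classical
  rw [kill_kill, Finset.union_self, sub_self]

theorem sub_kill_mem_span (S : Finset σ) (f : MvPowerSeries σ K) :
    f - kill S f ∈ Ideal.span (X '' (S : Set σ) : Set (MvPowerSeries σ K)) := by
  classical
  induction S using Finset.induction_on with
  | empty =>
    have : kill ∅ f = f := by ext n; simp [coeff_kill]
    simp [this]
  | insert a S _ ih =>
    have h1 : f - kill (insert a S) f = (f - kill S f) + (kill S f - kill {a} (kill S f)) := by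
      rw [kill_kill, Finset.insert_eq]; ring
    rw [h1]
    refine add_mem (Ideal.span_mono (Set.image_mono (by simp)) ih) ?_
    exact Ideal.mem_of_dvd _ (X_dvd_sub_kill a _) (Ideal.subset_span ⟨a, by simp, rfl⟩)

theorem mem_span_range_X [Fintype σ] {f : MvPowerSeries σ K} (hf : constantCoeff f = 0) :
    f ∈ Ideal.span (Set.range (X : σ → MvPowerSeries σ K)) := by
  have h0 : kill Finset.univ f = 0 := by
    ext n
    rw [coeff_kill]
    split_ifs with h
    · obtain rfl : n = 0 := by ext s; exact h s (Finset.mem_univ s)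
      simpa using hf
    · simp
  simpa [h0] using sub_kill_mem_span Finset.univ f

theorem X_dvd_X_iff {s t : σ} : (X s : MvPowerSeries σ K) ∣ X t ↔ s = t := by
  classical
  refine ⟨fun h => ?_, fun h => h ▸ dvd_rfl⟩
  by_contra hne
  rw [X_dvd_iff_kill_eq_zero, kill_X_of_notMem (by simpa using Ne.symm hne)] at h
  have := congrArg (coeff (Finsupp.single t 1)) h
  simp [coeff_X] at this

theorem prime_X (s : σ) : Prime (X s : MvPowerSeries σ K) := by
  classical
  refine ⟨fun h => ?_, fun h => ?_, fun a b h => ?_⟩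
  · have := congrArg (coeff (Finsupp.single s 1)) h
    simp [coeff_X] at this
  · rw [isUnit_iff_constantCoeff] at h
    simp at h
  · simpa only [X_dvd_iff_kill_eq_zero, map_mul, mul_eq_zero] using h

theorem prod_X_dvd {S : Finset σ} {f : MvPowerSeries σ K} (h : ∀ s ∈ S, X s ∣ f) :
    ∏ s ∈ S, X s ∣ f := by
  classical
  induction S using Finset.induction_on with
  | empty => simp
  | insert a S ha ih =>
    obtain ⟨g, rfl⟩ := ih fun s hs => h s (Finset.mem_insert_of_mem hs)
    rw [Finset.prod_insert ha, mul_comm]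
    refine mul_dvd_mul_left _ (((prime_X a).dvd_or_dvd (h a (by simp))).resolve_left fun hd => ?_)
    obtain ⟨s, hs, hd⟩ := (prime_X a).exists_mem_finset_dvd hd
    exact ha (X_dvd_X_iff.mp hd ▸ hs)

/-- `⋂ₛ (xₛ, y) ⊆ (∏ₛ xₛ, y)`, where the ideals `(xₛ, y)` are given as kernels of `kill`. -/
theorem exists_eq_prod_X_mul_add [DecidableEq σ] {A : Finset σ} {b : σ} {f : MvPowerSeries σ K}
    (h : ∀ s ∈ A, kill {s, b} f = 0) :
    ∃ a u, f = (∏ s ∈ A, X s) * a + X b * u := by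
  obtain ⟨a, ha⟩ : ∏ s ∈ A, X s ∣ kill {b} f := prod_X_dvd fun s hs => by
    rw [X_dvd_iff_kill_eq_zero, kill_kill]
    exact h s hs
  obtain ⟨u, hu⟩ := X_dvd_sub_kill b f
  exact ⟨a, u, by rw [← ha, ← hu]; ring⟩

theorem prod_X_mem_sq {A : Finset σ} (hA : 2 ≤ A.card) :
    ∏ s ∈ A, (X s : MvPowerSeries σ K) ∈
      Ideal.span (Set.range (X : σ → MvPowerSeries σ K)) ^ 2 := by
  refine Ideal.pow_le_pow_right hA ?_
  rw [← Finset.prod_const]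
  exact Ideal.prod_mem_prod fun s _ => Ideal.subset_span ⟨s, rfl⟩

theorem constantCoeff_ne_zero_of_notMem_sq [Fintype σ] {A : Finset σ} (hA : 2 ≤ A.card) {b : σ}
    {a u : MvPowerSeries σ K}
    (h : (∏ s ∈ A, X s) * a + X b * u ∉ Ideal.span (Set.range (X : σ → MvPowerSeries σ K)) ^ 2) :
    constantCoeff u ≠ 0 := by
  refine fun hu => h (add_mem (Ideal.mul_mem_right _ _ (prod_X_mem_sq hA)) ?_)
  rw [sq]
  exact Ideal.mul_mem_mul (Ideal.subset_span ⟨b, rfl⟩) (mem_span_range_X hu)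

variable {ι : Type*} [Fintype ι] {A : Finset σ} {y : ι → σ}

theorem kill_prod_X (hA : A.Nonempty) : kill A (∏ s ∈ A, (X s : MvPowerSeries σ K)) = 0 := by
  obtain ⟨s, hs⟩ := hA
  rw [map_prod]
  exact Finset.prod_eq_zero hs (kill_X_of_mem hs)

/-- If two of the factors vanish modulo `(x, y_j)`, then the cofactor of `∏ y` vanishes there. -/
theorem X_dvd_kill_of_two_factors [DecidableEq σ] [DecidableEq ι] (hA : A.Nonempty)
    (hy : Function.Injective y) (hyA : ∀ j, y j ∉ A)
    {h : ι → MvPowerSeries σ K} {g₁ g₂ : MvPowerSeries σ K}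
    (hf : ∏ i, h i = (∏ s ∈ A, X s) * g₁ + (∏ j, X (y j)) * g₂) {j i i' : ι} (hne : i ≠ i')
    (hi : X (y j) ∣ kill A (h i)) (hi' : X (y j) ∣ kill A (h i')) :
    X (y j) ∣ kill A g₂ := by
  have h1 : ∏ i, kill A (h i) = (∏ j, X (y j)) * kill A g₂ := by
    rw [← map_prod, hf, map_add, map_mul, map_mul, kill_prod_X hA, zero_mul, zero_add, map_prod]
    simp only [kill_X_of_notMem (hyA _)]
  rw [← Finset.mul_prod_erase _ _ (Finset.mem_univ i),
    ← Finset.mul_prod_erase _ _ (Finset.mem_erase.mpr ⟨hne.symm, Finset.mem_univ i'⟩),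
    ← Finset.mul_prod_erase _ _ (Finset.mem_univ j), mul_assoc (X (y j))] at h1
  have h2 : X (y j) * X (y j) ∣ X (y j) * ((∏ k ∈ Finset.univ.erase j, X (y k)) * kill A g₂) := by
    rw [← h1]
    exact mul_dvd_mul hi (hi'.mul_right _)
  have h3 := (mul_dvd_mul_iff_left (prime_X (y j)).ne_zero).mp h2
  refine ((prime_X (y j)).dvd_or_dvd h3).resolve_left fun hd => ?_
  obtain ⟨k, hk, hd⟩ := (prime_X (y j)).exists_mem_finset_dvd hd
  exact (Finset.mem_erase.mp hk).1 (hy (X_dvd_X_iff.mp hd)).symm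

/-- A product of elements of order one in `(∏ x, ∏ y)` either has a representation with unit
cofactor of `∏ y`, or in every representation that cofactor lies in some `(x, y_j)`. -/
theorem exists_isUnit_or_X_dvd_kill [Fintype σ] [DecidableEq σ] [DecidableEq ι] (hA : 2 ≤ A.card)
    (hy : Function.Injective y) (hyA : ∀ j, y j ∉ A) {h : ι → MvPowerSeries σ K}
    (hh : ∀ i, h i ∉ Ideal.span (Set.range (X : σ → MvPowerSeries σ K)) ^ 2)
    {g₁ g₂ : MvPowerSeries σ K}
    (hf : ∏ i, h i = (∏ s ∈ A, X s) * g₁ + (∏ j, X (y j)) * g₂) :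
    (∃ a u, IsUnit u ∧ ∏ i, h i = (∏ s ∈ A, X s) * a + (∏ j, X (y j)) * u) ∨
      ∃ j, X (y j) ∣ kill A g₂ := by
  have hne : A.Nonempty := Finset.card_pos.mp (by omega)
  by_cases huniq : ∃ j i i', i ≠ i' ∧ X (y j) ∣ kill A (h i) ∧ X (y j) ∣ kill A (h i')
  · obtain ⟨j, i, i', hii, hi, hi'⟩ := huniq
    exact .inr ⟨j, X_dvd_kill_of_two_factors hne hy hyA hf hii hi hi'⟩
  left
  have hex : ∀ j, ∀ s ∈ A, ∃ i, kill {s, y j} (h i) = 0 := fun j s hs => by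
    have h0 : ∏ i, kill {s, y j} (h i) = 0 := by
      rw [← map_prod, hf, map_add, map_mul, map_mul, map_prod, map_prod,
        Finset.prod_eq_zero hs (kill_X_of_mem (by simp)),
        Finset.prod_eq_zero (Finset.mem_univ j) (kill_X_of_mem (by simp))]
      simp
    simpa using Finset.prod_eq_zero_iff.mp h0
  have hdvd : ∀ j, ∀ s ∈ A, ∀ i, kill {s, y j} (h i) = 0 → X (y j) ∣ kill A (h i) := by
    intro j s hs i hi
    rw [X_dvd_iff_kill_eq_zero, kill_kill]
    have hAs : {y j} ∪ A = A ∪ {s, y j} := by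
      ext t; simp only [Finset.mem_union, Finset.mem_insert, Finset.mem_singleton]; grind
    rw [hAs, ← kill_kill, hi, map_zero]
  have hσ : ∀ j, ∃ i, ∀ s ∈ A, kill {s, y j} (h i) = 0 := by
    intro j
    obtain ⟨s₀, hs₀⟩ := hne
    obtain ⟨i, hi⟩ := hex j s₀ hs₀
    refine ⟨i, fun s hs => ?_⟩
    obtain ⟨i', hi'⟩ := hex j s hs
    obtain rfl : i = i' := by
      by_contra hii
      exact huniq ⟨j, i, i', hii, hdvd j s₀ hs₀ i hi, hdvd j s hs i' hi'⟩
    exact hi'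
  choose τ hτ using hσ
  choose a u hau using fun j => exists_eq_prod_X_mul_add (hτ j)
  have hu : ∀ j, constantCoeff (u j) ≠ 0 := fun j =>
    constantCoeff_ne_zero_of_notMem_sq hA (hau j ▸ hh (τ j))
  have hinj : Function.Injective τ := by
    intro j l hjl
    by_contra hne'
    have h1 := congrArg (kill A) ((hau j).symm.trans ((congrArg h hjl).trans (hau l)))
    simp only [map_add, map_mul, kill_prod_X hne, zero_mul, zero_add,
      kill_X_of_notMem (hyA _)] at h1
    obtain ⟨v, hv⟩ := ((prime_X (y j)).dvd_or_dvd (Dvd.intro _ h1)).resolve_left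
      fun hd => hne' (hy (X_dvd_X_iff.mp hd))
    apply hu l
    rw [← constantCoeff_kill A, hv]
    simp
  have hprod : ∏ j, h (τ j) = ∏ i, h i :=
    (Finite.injective_iff_bijective.mp hinj).prod_comp h
  have hmod : ∏ s ∈ A, X s ∣ ∏ i, h i - (∏ j, X (y j)) * ∏ j, u j := by
    rw [← hprod, ← Finset.prod_mul_distrib, ← Ideal.mem_span_singleton, ← Ideal.Quotient.eq,
      map_prod, map_prod]
    refine Finset.prod_congr rfl fun j _ => ?_
    rw [Ideal.Quotient.eq, Ideal.mem_span_singleton, hau j, add_sub_cancel_right]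
    exact dvd_mul_right _ _
  obtain ⟨c, hc⟩ := hmod
  refine ⟨c, ∏ j, u j, ?_, by rw [← hc]; ring⟩
  rw [isUnit_iff_constantCoeff, map_prod, isUnit_iff_ne_zero]
  exact Finset.prod_ne_zero_iff.mpr fun j _ => hu j

end Kill

end MvPowerSeries

/-- Proposition 5.7 of the paper: in `R = K[[x₁,…,x_{p-1}, y₁,…,y_q, w₁,…,w_t]]`
with `p ≥ 3`, if `f` is a product of `q` irreducible factors each of order `1`,
`f ∈ (x₁⋯x_{p-1}, y₁⋯y_q)`, and in every representation
`f = x₁⋯x_{p-1}·g₁ + y₁⋯y_q·g₂` the element `g₂` is a non-unit, then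
`f ∈ (x₁⋯x_{p-1}) + (y₁⋯y_q)·(x₁,…,x_{p-1},y₁,…,y_q)`. -/
theorem stmt_12 (K : Type*) [Field K] (p q t : ℕ) (hp : 3 ≤ p)
    (f : MvPowerSeries (Fin (p - 1) ⊕ Fin q ⊕ Fin t) K) :
    let R := MvPowerSeries (Fin (p - 1) ⊕ Fin q ⊕ Fin t) K
    let x : Fin (p - 1) → R := fun i => X (Sum.inl i)
    let y : Fin q → R := fun j => X (Sum.inr (Sum.inl j))
    let m : Ideal R := Ideal.span (Set.range (X : Fin (p - 1) ⊕ Fin q ⊕ Fin t → R))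
    let Px : R := ∏ i, x i
    let Py : R := ∏ j, y j
    (∃ h : Fin q → R, (∀ i, Irreducible (h i) ∧ h i ∈ m ∧ h i ∉ m ^ 2) ∧
        f = ∏ i, h i) →
    f ∈ Ideal.span {Px, Py} →
    (∀ g1 g2 : R, f = Px * g1 + Py * g2 → ¬ IsUnit g2) →
    f ∈ Ideal.span {Px} ⊔
        Ideal.span {Py} * Ideal.span ((Set.range x) ∪ (Set.range y)) := by
  intro R x y m Px Py ⟨h, hh, hfh⟩ hf hunit
  obtain ⟨g₁, g₂, hg⟩ := Ideal.mem_span_pair.mp hf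
  let A : Finset (Fin (p - 1) ⊕ Fin q ⊕ Fin t) := Finset.univ.map Function.Embedding.inl
  have hPx : ∏ s ∈ A, X s = Px := Finset.prod_map _ _ _
  have hrep : ∏ i, h i = (∏ s ∈ A, X s) * g₁ + (∏ j, X (Sum.inr (Sum.inl j))) * g₂ := by
    rw [hPx, ← hfh, ← hg, mul_comm g₁, mul_comm g₂]
  rcases exists_isUnit_or_X_dvd_kill (A := A) (y := fun j => Sum.inr (Sum.inl j))
    (by simp only [A, Finset.card_map, Finset.card_univ, Fintype.card_fin]; omega)
    (fun _ _ hjl => by simpa using hjl) (fun j => by simp [A]) (fun i => (hh i).2.2) hrep with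
    ⟨a, u, hu, hau⟩ | ⟨j, hj⟩
  · rw [← hfh, hPx] at hau
    exact absurd hu (hunit a u hau)
  · rw [← hg, mul_comm g₁, mul_comm g₂]
    refine Submodule.add_mem_sup
      (Ideal.mul_mem_right _ _ (Ideal.mem_span_singleton_self Px))
      (Ideal.mul_mem_mul (Ideal.mem_span_singleton_self Py) ?_)
    rw [← sub_add_cancel g₂ (kill A g₂)]
    refine add_mem (Ideal.span_mono ?_ (sub_kill_mem_span A g₂))
      (Ideal.mem_of_dvd _ hj (Ideal.subset_span (.inr ⟨j, rfl⟩)))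
    rintro _ ⟨s, hs, rfl⟩
    obtain ⟨i, -, rfl⟩ := Finset.mem_map.mp hs
    exact .inl ⟨i, rfl⟩
end

section
/- Let R be a formal power series ring over a field with x1,...,x_{p-1}, y1,...,yq among the variables, and let h ∈ R have order 1. Then h cannot be 'associated' to two distinct x_i's: if h ∈ (x_{i1}, y_{j1}) ∩ (x_{i2}, y_{j2}) with i1 ≠ i2, then either j1 = j2 and h ∈ (x_{i1}·x_{i2}, y_{j1}) (so h is congruent to a unit multiple of y_{j1} modulo order-2 terms), or h has order ≥ 2, a contradiction. Formally: if h has order 1 and h ∈ (x_{i1}, y_{j1}) ∩ (x_{i2}, y_{j2}) with i1 ≠ i2, then j1 = j2 and h = y_{j1}·u + a with u a unit and a of order ≥ 2. -/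
open MvPowerSeries

/-- A power series in finitely many variables with zero constant coefficient lies in the ideal
generated by the variables. -/
theorem MvPowerSeries.mem_span_range_X_of_constantCoeff_eq_zero {σ R : Type*} [Finite σ]
    [CommRing R] {φ : MvPowerSeries σ R} (hφ : constantCoeff φ = 0) :
    φ ∈ Ideal.span (Set.range (X : σ → MvPowerSeries σ R)) := by
  classical
  cases nonempty_fintype σ
  rcases isEmpty_or_nonempty σ with _ | _
  · have h0 : φ = 0 := by
      ext n
      simpa [Subsingleton.elim n 0] using hφ
    exact h0 ▸ zero_mem _
  have exists_var (n : σ →₀ ℕ) (hn : n ≠ 0) : ∃ s, n s ≠ 0 := by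
    simpa using DFunLike.ne_iff.mp hn
  choose! c hc using exists_var
  let part (s : σ) : MvPowerSeries σ R := fun n => if n ≠ 0 ∧ c n = s then coeff n φ else 0
  have coeff_part (s : σ) (n : σ →₀ ℕ) :
      coeff n (part s) = if n ≠ 0 ∧ c n = s then coeff n φ else 0 := rfl
  have hsum : φ = ∑ s, part s := by
    ext n
    rw [map_sum]
    simp only [coeff_part]
    by_cases hn : n = 0
    · subst hn
      simpa using hφ
    · simp [hn]
  rw [hsum]
  refine Ideal.sum_mem _ fun s _ => ?_
  refine Ideal.mem_of_dvd _ (X_dvd_iff.mpr fun n hn => ?_)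
    (Ideal.subset_span (Set.mem_range_self s))
  rw [coeff_part, if_neg]
  rintro ⟨hn0, rfl⟩
  exact hc n hn0 hn

theorem MvPowerSeries.coeff_single_mul_X_self {σ R : Type*} [CommSemiring R]
    (φ : MvPowerSeries σ R) (s : σ) :
    coeff (Finsupp.single s 1) (φ * X s) = constantCoeff φ := by
  simpa [X] using coeff_add_mul_monomial (R := R) 0 (Finsupp.single s 1) φ 1

theorem MvPowerSeries.coeff_single_mul_X_of_ne {σ R : Type*} [CommSemiring R]
    (φ : MvPowerSeries σ R) {s t : σ} (hst : s ≠ t) :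
    coeff (Finsupp.single t 1) (φ * X s) = 0 :=
  X_dvd_iff.mp (dvd_mul_left _ _) _ (by simp [hst])

/-- In `R = K[[x₁,…,x_m, y₁,…,y_q, w₁,…,w_s]]`, if `h` has order `1`
(i.e. `h ∈ 𝔪 \ 𝔪²`) and `h ∈ (x_{i₁}, y_{j₁}) ∩ (x_{i₂}, y_{j₂})` with
`i₁ ≠ i₂`, then `j₁ = j₂` and `h = y_{j₁}·u + a` with `u` a unit and
`a ∈ 𝔪²`. -/
theorem stmt_13 (K : Type*) [Field K] (m q s : ℕ)
    (h : MvPowerSeries (Fin m ⊕ Fin q ⊕ Fin s) K)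
    (i1 i2 : Fin m) (j1 j2 : Fin q) (hi : i1 ≠ i2) :
    let R := MvPowerSeries (Fin m ⊕ Fin q ⊕ Fin s) K
    let x : Fin m → R := fun i => X (Sum.inl i)
    let y : Fin q → R := fun j => X (Sum.inr (Sum.inl j))
    let M : Ideal R := Ideal.span (Set.range (X : Fin m ⊕ Fin q ⊕ Fin s → R))
    h ∈ M → h ∉ M ^ 2 →
    h ∈ Ideal.span {x i1, y j1} ⊓ Ideal.span {x i2, y j2} →
    j1 = j2 ∧ ∃ u a : R, IsUnit u ∧ a ∈ M ^ 2 ∧ h = y j1 * u + a := by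
  intro R x y M _ hM2 hmem
  obtain ⟨⟨a, b, hab⟩, ⟨c, d, hcd⟩⟩ :=
    And.imp Ideal.mem_span_pair.mp Ideal.mem_span_pair.mp (Submodule.mem_inf.mp hmem)
  have hX (s : Fin m ⊕ Fin q ⊕ Fin s) : (X s : R) ∈ M := Ideal.subset_span (Set.mem_range_self s)
  have mul_X_mem {f : R} (s : Fin m ⊕ Fin q ⊕ Fin s) (hf : constantCoeff f = 0) :
      f * X s ∈ M ^ 2 := by
    rw [sq]
    exact Ideal.mul_mem_mul (mem_span_range_X_of_constantCoeff_eq_zero hf) (hX s)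
  have ha : constantCoeff a = 0 := by
    have e := congrArg (coeff (Finsupp.single (Sum.inl i1) 1)) (hab.trans hcd.symm)
    simp only [x, y, map_add] at e
    rwa [coeff_single_mul_X_self, coeff_single_mul_X_of_ne b (by simp),
      coeff_single_mul_X_of_ne c (by simpa using hi.symm), coeff_single_mul_X_of_ne d (by simp),
      add_zero, add_zero] at e
  have hb : constantCoeff b ≠ 0 := fun hb =>
    hM2 (hab ▸ add_mem (mul_X_mem _ ha) (mul_X_mem _ hb))
  refine ⟨?_, b, a * x i1, ?_, mul_X_mem _ ha, ?_⟩
  · by_contra hj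
    have e := congrArg (coeff (Finsupp.single (Sum.inr (Sum.inl j1)) 1)) (hab.trans hcd.symm)
    simp only [x, y, map_add] at e
    rw [coeff_single_mul_X_self, coeff_single_mul_X_of_ne a (by simp),
      coeff_single_mul_X_of_ne c (by simp),
      coeff_single_mul_X_of_ne d (by simpa using Ne.symm hj), zero_add, add_zero] at e
    exact hb e
  · exact isUnit_iff_constantCoeff.mpr hb.isUnit
  · rw [← hab]
    ring
end
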